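/- For every integer m ≥ 0, ζ*({1}^m, 2) = (m+1)·ζ(m+2). -/

import Mathlib

open scoped BigOperators

/-- The multiple zeta value `ζ(a₁, …, a_r)`, as a sum over strictly increasing
tuples of positive integers. -/
noncomputable def mz (a : List ℕ) : ℝ :=
  ∑' k : {k : Fin a.length → ℕ+ // StrictMono k},
    ∏ i, (1 : ℝ) / ((k.1 i : ℕ) : ℝ) ^ a.get i

/-- The multiple zeta-star value `ζ⋆(a₁, …, a_r)`, as a sum over weakly increasing
tuples of positive integers. -/
noncomputable def mzs (a : List ℕ) : ℝ :=
  ∑' k : {k : Fin a.length → ℕ+ // Monotone k},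
    ∏ i, (1 : ℝ) / ((k.1 i : ℕ) : ℝ) ^ a.get i

/-- The coefficient of `x ^ m` in `n! / ∏ j ∈ {1, …, n}, (k + j - x)`. For `k = 0` this is the
complete homogeneous symmetric polynomial of degree `m` in `1, 1/2, …, 1/n`. -/
noncomputable def shiftedCoeff (k : ℕ) : ℕ → ℕ → ℝ
  | 0, 0 => 1
  | 0, _ + 1 => 0
  | n + 1, 0 => (n + 1) * shiftedCoeff k n 0 / (k + n + 1)
  | n + 1, m + 1 => (shiftedCoeff k (n + 1) m + (n + 1) * shiftedCoeff k n (m + 1)) / (k + n + 1)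

namespace shiftedCoeff

open Filter Topology

lemma nonneg (k n m : ℕ) : 0 ≤ shiftedCoeff k n m := by
  induction n generalizing m with
  | zero => cases m <;> simp [shiftedCoeff]
  | succ n ihn =>
    induction m with
    | zero => have := ihn 0; rw [shiftedCoeff]; positivity
    | succ m ihm => have := ihn (m + 1); rw [shiftedCoeff]; positivity

lemma one_left (k m : ℕ) : shiftedCoeff k 1 m = 1 / (k + 1) ^ (m + 1) := by
  induction m with
  | zero => simp [shiftedCoeff]
  | succ m ih =>
    rw [shiftedCoeff, ih]
    simp only [shiftedCoeff]
    have : (k : ℝ) + 1 ≠ 0 := by positivity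
    field_simp
    simp [pow_succ]

lemma recurrence_zero (k n : ℕ) :
    (k + n + 1) * shiftedCoeff k (n + 1) 0 = (n + 1) * shiftedCoeff k n 0 := by
  have : (k : ℝ) + n + 1 ≠ 0 := by positivity
  rw [shiftedCoeff]
  field_simp

lemma recurrence_succ (k n m : ℕ) :
    (k + n + 1) * shiftedCoeff k (n + 1) (m + 1) =
      shiftedCoeff k (n + 1) m + (n + 1) * shiftedCoeff k n (m + 1) := by
  have : (k : ℝ) + n + 1 ≠ 0 := by positivity
  rw [shiftedCoeff]
  field_simp

lemma sub_shift (k n m : ℕ) :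
    (n + 1) * (shiftedCoeff k n m - shiftedCoeff (k + 1) n m) =
      n * shiftedCoeff k (n + 1) m := by
  induction n generalizing m with
  | zero => cases m <;> simp [shiftedCoeff]
  | succ n ihn =>
    have h0 : (k : ℝ) + n + 2 ≠ 0 := by positivity
    induction m with
    | zero =>
      have h1 := recurrence_zero k n
      have h2 := recurrence_zero (k + 1) n
      have h3 := recurrence_zero k (n + 1)
      have h4 := ihn 0
      push_cast at *
      apply mul_left_cancel₀ h0
      linear_combination (n + 2) * h1 - (n + 2) * h2 - (n + 1) * h3 + (n + 2) * h4
    | succ m ihm =>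
      have h1 := recurrence_succ k n m
      have h2 := recurrence_succ (k + 1) n m
      have h3 := recurrence_succ k (n + 1) m
      have h4 := ihn (m + 1)
      push_cast at *
      apply mul_left_cancel₀ h0
      linear_combination (n + 2) * h1 - (n + 2) * h2 - (n + 1) * h3 + (n + 2) * h4 + ihm

lemma le_div (k n m : ℕ) :
    shiftedCoeff k (n + 1) m ≤ shiftedCoeff 0 (n + 1) m / (k + 1) := by
  have hk : (1 : ℝ) ≤ k + 1 := by simp
  induction n generalizing m with
  | zero =>
    rw [one_left, one_left, pow_succ]
    simp only [Nat.cast_zero, zero_add, one_pow, div_one]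
    gcongr
    exact le_mul_of_one_le_left (by positivity) (one_le_pow₀ hk)
  | succ n ihn =>
    have hn : ((0 : ℕ) : ℝ) + (n + 1 : ℕ) + 1 ≤ k + (n + 1 : ℕ) + 1 := by simp
    induction m with
    | zero =>
      rw [shiftedCoeff, shiftedCoeff.eq_3 0, div_right_comm, mul_div_assoc _ _ ((k : ℝ) + 1)]
      have := nonneg 0 (n + 1) 0
      gcongr
      exact ihn 0
    | succ m ihm =>
      rw [shiftedCoeff, shiftedCoeff.eq_4 0, div_right_comm, add_div _ _ ((k : ℝ) + 1),
        mul_div_assoc _ _ ((k : ℝ) + 1)]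
      have := nonneg 0 (n + 1) (m + 1)
      have := nonneg 0 (n + 1 + 1) m
      gcongr
      exact ihn (m + 1)

lemma zero_le_sqrt (n m : ℕ) :
    shiftedCoeff 0 (n + 1) m ≤ 2 ^ m * √((n : ℝ) + 1) := by
  induction n generalizing m with
  | zero => rw [one_left]; simpa using one_le_pow₀ (by norm_num : (1 : ℝ) ≤ 2)
  | succ n ihn =>
    have hs : √((n : ℝ) + 1) ≤ √((n : ℝ) + 2) := Real.sqrt_le_sqrt (by linarith)
    have h1 : √((n : ℝ) + 1) ^ 2 = n + 1 := Real.sq_sqrt (by positivity)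
    have h2 : √((n : ℝ) + 2) ^ 2 = n + 2 := Real.sq_sqrt (by positivity)
    have hp : (0 : ℝ) < n + 2 := by positivity
    have e : ((n + 1 : ℕ) : ℝ) + 1 = n + 2 := by push_cast; ring
    rw [e]
    induction m with
    | zero =>
      have h := recurrence_zero 0 (n + 1)
      have h4 := ihn 0
      push_cast at h
      have : shiftedCoeff 0 (n + 1 + 1) 0 = shiftedCoeff 0 (n + 1) 0 := by
        apply mul_left_cancel₀ hp.ne'
        linear_combination h
      rw [this]
      linarith
    | succ m ihm =>
      have h := recurrence_succ 0 (n + 1) m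
      have h4 := ihn (m + 1)
      push_cast at h
      refine le_of_mul_le_mul_left ?_ hp
      have key : √((n : ℝ) + 2) + (n + 2) * (2 * √((n : ℝ) + 1)) ≤
          (n + 2) * (2 * √((n : ℝ) + 2)) := by
        nlinarith [sq_nonneg (√((n : ℝ) + 2) - √((n : ℝ) + 1)), Real.sqrt_nonneg ((n : ℝ) + 2)]
      have := mul_le_mul_of_nonneg_left key (by positivity : (0 : ℝ) ≤ 2 ^ m)
      have := mul_le_mul_of_nonneg_left h4 hp.le
      rw [pow_succ] at *
      nlinarith

lemma tendsto_div (k m : ℕ) :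
    Tendsto (fun n : ℕ ↦ shiftedCoeff k (n + 1) m / (n + 1)) atTop (𝓝 0) := by
  have hlim : Tendsto (fun n : ℕ ↦ (2 : ℝ) ^ m / √((n : ℝ) + 1)) atTop (𝓝 0) :=
    (Real.tendsto_sqrt_atTop.comp
      (tendsto_atTop_add_const_right _ 1 tendsto_natCast_atTop_atTop)).const_div_atTop _
  refine squeeze_zero (fun n ↦ div_nonneg (nonneg ..) (by positivity)) (fun n ↦ ?_) hlim
  have h : shiftedCoeff k (n + 1) m ≤ 2 ^ m * √((n : ℝ) + 1) :=
    (le_div k n m).trans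
      ((div_le_self (nonneg ..) (by simp)).trans (zero_le_sqrt n m))
  have hs : √((n : ℝ) + 1) * √((n : ℝ) + 1) = n + 1 := Real.mul_self_sqrt (by positivity)
  rw [div_le_div_iff₀ (by positivity) (by positivity)]
  calc shiftedCoeff k (n + 1) m * √((n : ℝ) + 1)
      ≤ 2 ^ m * √((n : ℝ) + 1) * √((n : ℝ) + 1) := by gcongr
    _ = 2 ^ m * (n + 1) := by rw [mul_assoc, hs]

lemma sum_range_zero (k N : ℕ) :
    (k + 1) * ∑ n ∈ Finset.range N, shiftedCoeff k (n + 2) 0 / ((n + 1) * (n + 2)) =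
      1 / (k + 1) - shiftedCoeff k (N + 1) 0 / (N + 1) := by
  induction N with
  | zero => simp [one_left]
  | succ N ih =>
    rw [Finset.sum_range_succ, mul_add, ih]
    have h := recurrence_zero k (N + 1)
    push_cast at *
    rw [show (N : ℝ) + 1 + 1 = N + 2 by ring] at *
    field_simp
    linear_combination (k + 1) * h

lemma sum_range_succ (k m N : ℕ) :
    (k + 1) * ∑ n ∈ Finset.range N, shiftedCoeff k (n + 2) (m + 1) / ((n + 1) * (n + 2)) =
      ∑ n ∈ Finset.range N, shiftedCoeff k (n + 2) m / ((n + 1) * (n + 2)) +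
        (1 / (k + 1) ^ (m + 2) - shiftedCoeff k (N + 1) (m + 1) / (N + 1)) := by
  induction N with
  | zero => simp [one_left]
  | succ N ih =>
    rw [Finset.sum_range_succ, Finset.sum_range_succ, mul_add, ih]
    have h := recurrence_succ k (N + 1) m
    push_cast at *
    rw [show (N : ℝ) + 1 + 1 = N + 2 by ring] at *
    field_simp
    linear_combination (k + 1) ^ (m + 2) * h

lemma hasSum_div_mul (k m : ℕ) :
    HasSum (fun n : ℕ ↦ shiftedCoeff k (n + 2) m / ((n + 1) * (n + 2)))
      ((m + 1) / (k + 1) ^ (m + 2)) := by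
  have hk : (k : ℝ) + 1 ≠ 0 := by positivity
  rw [hasSum_iff_tendsto_nat_of_nonneg fun n ↦ div_nonneg (nonneg ..) (by positivity)]
  induction m with
  | zero =>
    have h := ((tendsto_div k 0).const_sub (1 / ((k : ℝ) + 1))).div_const ((k : ℝ) + 1)
    refine (h.congr fun N ↦ ?_).trans_eq ?_
    · rw [← sum_range_zero]; field_simp
    · congr 1; field_simp; simp
  | succ m ih =>
    have h := (ih.add ((tendsto_div k (m + 1)).const_sub
      (1 / ((k : ℝ) + 1) ^ (m + 2)))).div_const ((k : ℝ) + 1)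
    refine (h.congr fun N ↦ ?_).trans_eq ?_
    · rw [← sum_range_succ]; field_simp
    · congr 1; field_simp; push_cast; ring

lemma summable_div_sq (k m : ℕ) :
    Summable (fun n : ℕ ↦ shiftedCoeff k (n + 1) m / (n + 1) ^ 2) := by
  rw [← summable_nat_add_iff 1]
  refine (hasSum_div_mul k m).summable.of_nonneg_of_le
    (fun n ↦ div_nonneg (nonneg ..) (by positivity)) fun n ↦ ?_
  have := nonneg k (n + 2) m
  push_cast
  gcongr
  nlinarith

lemma tsum_sub_tsum (k m : ℕ) :
    ∑' n : ℕ, shiftedCoeff k (n + 1) m / (n + 1) ^ 2 -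
      ∑' n : ℕ, shiftedCoeff (k + 1) (n + 1) m / (n + 1) ^ 2 =
        ((m : ℝ) + 1) / (k + 1) ^ (m + 2) := by
  rw [← (summable_div_sq k m).tsum_sub (summable_div_sq (k + 1) m),
    ← (hasSum_div_mul k m).tsum_eq]
  congr 1 with n
  have h := sub_shift k (n + 1) m
  push_cast at h
  field_simp
  linear_combination h

lemma hasSum_zero_div_sq (m : ℕ) :
    HasSum (fun k : ℕ ↦ ((m : ℝ) + 1) / (k + 1) ^ (m + 2))
      (∑' n : ℕ, shiftedCoeff 0 (n + 1) m / (n + 1) ^ 2) := by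
  set G : ℕ → ℝ := fun k ↦ ∑' n : ℕ, shiftedCoeff k (n + 1) m / (n + 1) ^ 2 with hG
  have hlim : Tendsto G atTop (𝓝 0) := by
    have h0 : Tendsto (fun k : ℕ ↦ G 0 / ((k : ℝ) + 1)) atTop (𝓝 0) :=
      (tendsto_atTop_add_const_right _ 1 tendsto_natCast_atTop_atTop).const_div_atTop _
    refine squeeze_zero
      (fun k ↦ tsum_nonneg fun n ↦ div_nonneg (nonneg ..) (by positivity)) (fun k ↦ ?_) h0
    rw [hG]
    simp only
    rw [← tsum_div_const]
    refine (summable_div_sq k m).tsum_le_tsum (fun n ↦ ?_) ((summable_div_sq 0 m).div_const _)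
    rw [div_right_comm]
    gcongr
    exact le_div k n m
  rw [hasSum_iff_tendsto_nat_of_nonneg fun k ↦ by positivity]
  refine ((hlim.const_sub (G 0)).congr fun N ↦ ?_).trans_eq (by simp [hG])
  rw [← Finset.sum_range_sub']
  exact Finset.sum_congr rfl fun k _ ↦ tsum_sub_tsum k m

lemma zero_succ_eq_sum (n m : ℕ) :
    shiftedCoeff 0 n (m + 1) = ∑ a ∈ Finset.range n, shiftedCoeff 0 (a + 1) m / (a + 1) := by
  induction n with
  | zero => simp [shiftedCoeff]
  | succ n ih =>
    rw [Finset.sum_range_succ, ← ih, shiftedCoeff]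
    field_simp
    push_cast
    ring

lemma zero_zero (n : ℕ) : shiftedCoeff 0 n 0 = 1 := by
  induction n with
  | zero => simp [shiftedCoeff]
  | succ n ih =>
    rw [shiftedCoeff, ih]
    field_simp
    push_cast
    ring

end shiftedCoeff

open scoped ENNReal

lemma monotone_snoc_iff {m : ℕ} (k : Fin (m + 1) → ℕ+) (n : ℕ+) :
    Monotone (Fin.snoc (α := fun _ ↦ ℕ+) k n) ↔ Monotone k ∧ k (Fin.last m) ≤ n := by
  rw [Fin.monotone_iff_le_succ, Fin.monotone_iff_le_succ, Fin.forall_fin_succ']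
  simp only [← Fin.castSucc_succ, Fin.snoc_castSucc, Fin.succ_last, Fin.snoc_last]

open Classical in
/-- The sum of `f` over the last entry of weakly increasing tuples of positive integers, the other
entries having weight equal to their inverses. -/
noncomputable def monotoneSum (m : ℕ) (f : ℕ+ → ℝ≥0∞) : ℝ≥0∞ :=
  ∑' k : Fin (m + 1) → ℕ+, if Monotone k then
    (∏ i : Fin m, ENNReal.ofReal (1 / ((k i.castSucc : ℕ) : ℝ))) * f (k (Fin.last m)) else 0

lemma monotoneSum_zero (f : ℕ+ → ℝ≥0∞) : monotoneSum 0 f = ∑' n, f n := by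
  rw [monotoneSum, ← (Equiv.funUnique (Fin 1) ℕ+).symm.tsum_eq]
  congr 1 with n
  rw [if_pos (Subsingleton.monotone (α := Fin 1) _)]
  simp

lemma monotoneSum_succ (m : ℕ) (f : ℕ+ → ℝ≥0∞) :
    monotoneSum (m + 1) f = monotoneSum m fun a ↦
      ENNReal.ofReal (1 / ((a : ℕ) : ℝ)) * ∑' n : ℕ+, if a ≤ n then f n else 0 := by
  rw [monotoneSum, monotoneSum, ← (Fin.snocEquiv fun _ ↦ ℕ+).tsum_eq,
    ← (Equiv.prodComm _ _).tsum_eq, ENNReal.tsum_prod']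
  congr 1 with k
  have hs (n : ℕ+) : Monotone (Fin.snocEquiv (fun _ ↦ ℕ+) (n, k)) ↔
      Monotone k ∧ k (Fin.last m) ≤ n := monotone_snoc_iff k n
  simp only [Equiv.prodComm_apply, Prod.swap_prod_mk, hs, Fin.snocEquiv_apply,
    Fin.snoc_castSucc, Fin.snoc_last]
  by_cases hk : Monotone k
  · simp only [hk, true_and, if_true]
    rw [← mul_assoc, ← Fin.prod_univ_castSucc (fun i ↦ ENNReal.ofReal (1 / ((k i : ℕ) : ℝ))),
      ← ENNReal.tsum_mul_left]
    simp
  · simp [hk]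

lemma monotoneSum_eq_tsum (m : ℕ) (f : ℕ+ → ℝ≥0∞) :
    monotoneSum m f = ∑' n : ℕ+, ENNReal.ofReal (shiftedCoeff 0 n m) * f n := by
  induction m generalizing f with
  | zero => simp [monotoneSum_zero, shiftedCoeff.zero_zero]
  | succ m ih =>
    rw [monotoneSum_succ, ih]
    simp_rw [← mul_assoc, ← ENNReal.tsum_mul_left]
    rw [ENNReal.tsum_comm]
    congr 1 with n
    simp_rw [mul_ite, mul_zero, ← ite_zero_mul]
    rw [ENNReal.tsum_mul_right]
    congr 1
    rw [shiftedCoeff.zero_succ_eq_sum, ENNReal.ofReal_sum_of_nonneg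
      fun a _ ↦ div_nonneg (shiftedCoeff.nonneg ..) (by positivity),
      ← Equiv.pnatEquivNat.symm.tsum_eq, tsum_eq_sum (s := Finset.range n)]
    · refine Finset.sum_congr rfl fun a ha ↦ ?_
      rw [Finset.mem_range] at ha
      have : Equiv.pnatEquivNat.symm a ≤ n := by
        rw [← PNat.coe_le_coe]; simpa using ha
      rw [if_pos this, ← ENNReal.ofReal_mul (shiftedCoeff.nonneg ..)]
      simp [div_eq_mul_inv]
    · intro a ha
      rw [Finset.mem_range] at ha
      rw [if_neg, zero_mul]
      refine fun h ↦ ha ?_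
      rw [← PNat.coe_le_coe] at h
      simpa using h

lemma mzs_eq_tsum_fin (a : List ℕ) {M : ℕ} (h : a.length = M) :
    mzs a = ∑' k : {k : Fin M → ℕ+ // Monotone k},
      ∏ i, (1 : ℝ) / ((k.1 i : ℕ) : ℝ) ^ a.get (i.cast h.symm) := by
  subst h
  rfl

lemma mzs_replicate_one_append_two (m : ℕ) :
    mzs (List.replicate m 1 ++ [2]) =
      (monotoneSum m fun n ↦ ENNReal.ofReal (1 / ((n : ℕ) : ℝ) ^ 2)).toReal := by
  classical
  rw [mzs_eq_tsum_fin _ (M := m + 1) (by simp), monotoneSum,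
    ENNReal.tsum_toReal_eq fun k ↦ ?_]
  · refine (tsum_subtype {k : Fin (m + 1) → ℕ+ | Monotone k} fun k ↦
      ∏ i, (1 : ℝ) / ((k i : ℕ) : ℝ) ^ (List.replicate m 1 ++ [2]).get
        (i.cast (by simp))).trans ?_
    congr 1 with k
    by_cases hk : Monotone k
    · rw [Set.indicator_of_mem (by exact hk), if_pos hk, ENNReal.toReal_mul, ENNReal.toReal_prod,
        Fin.prod_univ_castSucc, ENNReal.toReal_ofReal (by positivity)]
      congr 1
      · refine Finset.prod_congr rfl fun i _ ↦ ?_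
        rw [ENNReal.toReal_ofReal (by positivity)]
        simp
      · simp
    · rw [Set.indicator_of_notMem (by exact hk), if_neg hk, ENNReal.toReal_zero]
  · split_ifs
    · exact ENNReal.mul_ne_top (ENNReal.prod_ne_top fun _ _ ↦ ENNReal.ofReal_ne_top)
        ENNReal.ofReal_ne_top
    · simp

lemma mz_singleton (s : ℕ) : mz [s] = ∑' n : ℕ, (1 : ℝ) / ((n : ℝ) + 1) ^ s := by
  let e : ℕ+ ≃ {k : Fin [s].length → ℕ+ // StrictMono k} :=
    (Equiv.funUnique (Fin 1) ℕ+).symm.trans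
      (Equiv.subtypeUnivEquiv fun k ↦ Subsingleton.strictMono (α := Fin 1) k).symm
  rw [mz, ← (Equiv.pnatEquivNat.symm.trans e).tsum_eq]
  congr 1 with n
  exact (Fin.prod_univ_one _).trans (by simp [e])

/-- For every integer `m ≥ 0`, `ζ⋆({1}^m, 2) = (m+1) ζ(m+2)`. -/
theorem zetaStar_one_pow_two (m : ℕ) :
    mzs (List.replicate m 1 ++ [2]) = ((m : ℝ) + 1) * mz [m + 2] := by
  rw [mzs_replicate_one_append_two, monotoneSum_eq_tsum, mz_singleton, ← tsum_mul_left,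
    ENNReal.tsum_toReal_eq fun n ↦ ENNReal.mul_ne_top ENNReal.ofReal_ne_top ENNReal.ofReal_ne_top]
  simp_rw [mul_one_div]
  rw [(shiftedCoeff.hasSum_zero_div_sq m).tsum_eq, ← Equiv.pnatEquivNat.symm.tsum_eq]
  congr 1 with n
  rw [ENNReal.toReal_mul, ENNReal.toReal_ofReal (shiftedCoeff.nonneg ..),
    ENNReal.toReal_ofReal (by positivity)]
  simp [div_eq_mul_inv]
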